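/- arXiv:2108.06052 — 8 statements merged into one kernel-verified Lean document; each statement's English description precedes it below -/
import Mathlib

section
/- For every integer j ≥ 1 and every p ∈ M, the spliced pieces of the shrinking breather agree at the junction time: y_j p τ_{j-1} = y_{j-1} p τ_{j-1}. -/
/-- For every integer `j ≥ 1` and every `p ∈ M`, the spliced pieces of the
shrinking breather agree at the junction time: `y_j p τ_{j-1} = y_{j-1} p τ_{j-1}`.
Here `τ' j` denotes `τ_{j-1} = ∑_{k=0}^{j-1} α^{-2k}` (so `τ' 0 = 0`). -/
theorem spliced_shrinking_breather_junction
    {N : ℕ} (hN : 0 < N) {M : Type*} [Nonempty M]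
    (φ : M ≃ M) (α : ℝ) (hα0 : 0 < α) (hα1 : α < 1)
    (R : EuclideanSpace ℝ (Fin N) ≃ₗᵢ[ℝ] EuclideanSpace ℝ (Fin N))
    (V : EuclideanSpace ℝ (Fin N))
    (y₀ : M → ℝ → EuclideanSpace ℝ (Fin N))
    (hbreather : ∀ p : M, y₀ p 1 = α⁻¹ • R (y₀ (φ⁻¹ p) 0) + V)
    (τ' : ℕ → ℝ)
    (hτ' : ∀ j : ℕ, τ' j = ∑ k ∈ Finset.range j, α ^ (-(2 * k : ℤ)))
    (y : ℕ → M → ℝ → EuclideanSpace ℝ (Fin N))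
    (hy : ∀ (j : ℕ) (p : M) (τ : ℝ), y j p τ =
      α ^ (-(j : ℤ)) • (R ^ j) (y₀ ((φ⁻¹ ^ j) p) (α ^ (2 * j) * (τ - τ' j))) +
      ∑ k ∈ Finset.range j, α ^ (-(k : ℤ)) • (R ^ k) V) :
    ∀ j : ℕ, 1 ≤ j → ∀ p : M, y j p (τ' j) = y (j - 1) p (τ' j) := by
  intro j hj p
  obtain ⟨n, rfl⟩ : ∃ n, j = n + 1 := ⟨j - 1, by omega⟩
  have hα : α ≠ 0 := hα0.ne'
  have h1 : α ^ (2 * n) * (τ' (n + 1) - τ' n) = 1 := by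
    rw [hτ' (n + 1), Finset.sum_range_succ, ← hτ' n, add_sub_cancel_left, zpow_neg]
    have : α ^ ((2 : ℤ) * (n : ℤ)) = α ^ (2 * n) := by
      exact_mod_cast zpow_natCast α (2 * n)
    rw [this]
    exact mul_inv_cancel₀ (pow_ne_zero _ hα)
  have h2 : (φ⁻¹ ^ (n + 1)) p = φ⁻¹ ((φ⁻¹ ^ n) p) := by
    rw [pow_succ']; rfl
  have h3 : ∀ v, (R ^ (n + 1)) v = (R ^ n) (R v) := by
    intro v; rw [pow_succ]; rfl
  have h4 : α ^ (-((n + 1 : ℕ) : ℤ)) = α ^ (-(n : ℤ)) * α⁻¹ := by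
    simp only [zpow_neg, zpow_natCast, pow_succ, mul_inv]
  rw [Nat.add_sub_cancel, hy (n + 1), hy n, h1, hbreather, sub_self, mul_zero, h2, h3, h4,
    Finset.sum_range_succ, map_add, map_smul, smul_add, smul_smul]
  abel
end

section
/- Assume additionally that for each p ∈ M the map τ ↦ y₀ p τ is differentiable at 0 and at 1, and that the time derivatives satisfy the equivariance (d/dτ)(y₀ p)(1) = α • R ((d/dτ)(y₀ (φ⁻¹ p))(0)) for all p ∈ M. Then for every j ≥ 1 and every p ∈ M, the derivative of τ ↦ y_j p τ at τ_{j-1} equals the derivative of τ ↦ y_{j-1} p τ at τ_{j-1}, and both equal α^{j} • R^{j} ((d/dτ)(y₀ (φ^{-j} p))(0)). -/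
/-- Under differentiability of `τ ↦ y₀ p τ` at `0` and `1` and the
first-derivative equivariance `(y₀ p)'(1) = α • R ((y₀ (φ⁻¹ p))'(0))`, for every `j ≥ 1`
and every `p`, the derivatives of the spliced pieces `y_j` and `y_{j-1}` agree at the
junction time `τ_{j-1}`, and both equal `α^j • R^j ((y₀ (φ^{-j} p))'(0))`.
Here `τ' j` denotes `τ_{j-1} = ∑_{k=0}^{j-1} α^{-2k}`. -/
theorem spliced_shrinking_breather_deriv_junction
    {N : ℕ} (hN : 0 < N) {M : Type*} [Nonempty M]
    (φ : M ≃ M) (α : ℝ) (hα0 : 0 < α) (hα1 : α < 1)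
    (R : EuclideanSpace ℝ (Fin N) ≃ₗᵢ[ℝ] EuclideanSpace ℝ (Fin N))
    (V : EuclideanSpace ℝ (Fin N))
    (y₀ : M → ℝ → EuclideanSpace ℝ (Fin N))
    (hbreather : ∀ p : M, y₀ p 1 = α⁻¹ • R (y₀ (φ⁻¹ p) 0) + V)
    (τ' : ℕ → ℝ)
    (hτ' : ∀ j : ℕ, τ' j = ∑ k ∈ Finset.range j, α ^ (-(2 * k : ℤ)))
    (y : ℕ → M → ℝ → EuclideanSpace ℝ (Fin N))
    (hy : ∀ (j : ℕ) (p : M) (τ : ℝ), y j p τ =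
      α ^ (-(j : ℤ)) • (R ^ j) (y₀ ((φ⁻¹ ^ j) p) (α ^ (2 * j) * (τ - τ' j))) +
      ∑ k ∈ Finset.range j, α ^ (-(k : ℤ)) • (R ^ k) V)
    (hdiff0 : ∀ p : M, DifferentiableAt ℝ (y₀ p) 0)
    (hdiff1 : ∀ p : M, DifferentiableAt ℝ (y₀ p) 1)
    (hequiv : ∀ p : M, deriv (y₀ p) 1 = α • R (deriv (y₀ (φ⁻¹ p)) 0)) :
    ∀ j : ℕ, 1 ≤ j → ∀ p : M,
      deriv (fun τ => y j p τ) (τ' j) = deriv (fun τ => y (j - 1) p τ) (τ' j) ∧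
      deriv (fun τ => y j p τ) (τ' j) =
        α ^ j • (R ^ j) (deriv (y₀ ((φ⁻¹ ^ j) p)) 0) := by
  have hα : α ≠ 0 := hα0.ne'
  have key : ∀ (j : ℕ) (p : M) (t s : ℝ), α ^ (2 * j) * (t - τ' j) = s →
      DifferentiableAt ℝ (y₀ ((φ⁻¹ ^ j) p)) s →
      deriv (fun τ => y j p τ) t = α ^ j • (R ^ j) (deriv (y₀ ((φ⁻¹ ^ j) p)) s) := by
    intro j p t s hs hd
    have h1 : HasDerivAt (fun τ : ℝ => α ^ (2 * j) * (τ - τ' j)) (α ^ (2 * j)) t := by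
      simpa using ((hasDerivAt_id t).sub_const (τ' j)).const_mul (α ^ (2 * j))
    have h2 : HasDerivAt (fun τ : ℝ => y₀ ((φ⁻¹ ^ j) p) (α ^ (2 * j) * (τ - τ' j)))
        (α ^ (2 * j) • deriv (y₀ ((φ⁻¹ ^ j) p)) s) t := by
      subst hs
      exact hd.hasDerivAt.scomp t h1
    have h3 := ((R ^ j).toContinuousLinearEquiv.toContinuousLinearMap.hasFDerivAt.comp_hasDerivAt
      t h2)
    have h4 := (h3.const_smul (α ^ (-(j : ℤ)))).add_const
      (∑ k ∈ Finset.range j, α ^ (-(k : ℤ)) • (R ^ k) V)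
    have h5 : (fun τ => y j p τ) = fun τ => α ^ (-(j : ℤ)) •
        (R ^ j) (y₀ ((φ⁻¹ ^ j) p) (α ^ (2 * j) * (τ - τ' j))) +
        ∑ k ∈ Finset.range j, α ^ (-(k : ℤ)) • (R ^ k) V := funext (hy j p)
    rw [h5]
    refine (HasDerivAt.deriv h4).trans ?_
    have h6 : α ^ (-(j : ℤ)) * α ^ (2 * j) = α ^ j := by
      rw [zpow_neg, zpow_natCast, two_mul, pow_add]
      field_simp
    change α ^ (-(j : ℤ)) • (R ^ j) (α ^ (2 * j) • deriv (y₀ ((φ⁻¹ ^ j) p)) s) = _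
    rw [map_smul, smul_smul, h6]
  intro j hj p
  obtain ⟨n, rfl⟩ : ∃ n, j = n + 1 := ⟨j - 1, by omega⟩
  have hA := key (n + 1) p (τ' (n + 1)) 0 (by simp) (hdiff0 _)
  refine ⟨?_, hA⟩
  have hs : α ^ (2 * n) * (τ' (n + 1) - τ' n) = 1 := by
    rw [hτ', hτ', Finset.sum_range_succ, add_sub_cancel_left, zpow_neg]
    have : α ^ (2 * (n : ℤ)) = α ^ (2 * n) := by
      rw [← zpow_natCast]; push_cast; rfl
    rw [this]
    exact mul_inv_cancel₀ (pow_ne_zero _ hα)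
  have hB := key n p (τ' (n + 1)) 1 hs (hdiff1 _)
  rw [hA, Nat.add_sub_cancel, hB, hequiv, map_smul, smul_smul, ← pow_succ]
  have e1 : (φ⁻¹ ^ (n + 1)) p = φ⁻¹ ((φ⁻¹ ^ n) p) := by
    rw [pow_succ']; rfl
  rw [e1, pow_succ R]
  rfl
end

section
/- Let k ≥ 1 be an integer. Assume additionally that for each p ∈ M the map τ ↦ y₀ p τ is k-times differentiable at 0 and at 1, and that the k-th time derivatives satisfy the equivariance (d^k/dτ^k)(y₀ p)(1) = α^{2k−1} • R ((d^k/dτ^k)(y₀ (φ⁻¹ p))(0)) for all p ∈ M. Then for every j ≥ 1 and every p ∈ M, the k-th derivative of τ ↦ y_j p τ at τ_{j-1} equals the k-th derivative of τ ↦ y_{j-1} p τ at τ_{j-1}, and both equal α^{(2k−1)j} • R^{j} ((d^k/dτ^k)(y₀ (φ^{-j} p))(0)). -/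
lemma aux_iteratedDeriv_comp_mul {F : Type*} [NormedAddCommGroup F] [NormedSpace ℝ F]
    (n : ℕ) (f : ℝ → F) (c : ℝ) :
    iteratedDeriv n (fun x => f (c * x)) = fun x => c ^ n • iteratedDeriv n f (c * x) := by
  induction n with
  | zero => simp
  | succ n ih =>
    funext x
    rw [iteratedDeriv_succ, ih, iteratedDeriv_succ]
    have h := deriv_comp_mul_left c (iteratedDeriv n f) x
    have h2 := deriv_const_smul_field (c ^ n) (fun x => iteratedDeriv n f (c * x)) (x := x)
    simp only [Pi.smul_def] at h2
    rw [h2, h, smul_smul, pow_succ]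

lemma aux_iteratedDeriv_isom {F : Type*} [NormedAddCommGroup F] [NormedSpace ℝ F]
    (n : ℕ) (f : ℝ → F) (L : F ≃ₗᵢ[ℝ] F) (x : ℝ) :
    iteratedDeriv n (fun x => L (f x)) x = L (iteratedDeriv n f x) := by
  have h := L.toContinuousLinearEquiv.iteratedFDeriv_comp_left (f := f) (x := x) (i := n)
  have h2 := congrArg (fun m => m (fun _ => (1 : ℝ))) h
  exact h2

lemma aux_piece {F : Type*} [NormedAddCommGroup F] [NormedSpace ℝ F]
    (n : ℕ) (hn : 0 < n) (f : ℝ → F) (L : F ≃ₗᵢ[ℝ] F) (a c s : ℝ) (W : F) (x : ℝ) :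
    iteratedDeriv n (fun x => a • L (f (c * (x - s))) + W) x =
      (a * c ^ n) • L (iteratedDeriv n f (c * (x - s))) := by
  simp only [add_comm _ W]
  rw [iteratedDeriv_const_add hn, iteratedDeriv_fun_const_smul_field,
    aux_iteratedDeriv_isom n (fun x => f (c * (x - s))) L,
    iteratedDeriv_comp_sub_const n (fun x => f (c * x)) s, aux_iteratedDeriv_comp_mul]
  simp [smul_smul]

lemma aux_pow (α : ℝ) (h : α ≠ 0) (k j : ℕ) (hk : 1 ≤ k) :
    α ^ (-(j : ℤ)) * (α ^ (2 * j)) ^ k = α ^ ((2 * k - 1) * j) := by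
  obtain ⟨m, rfl⟩ := Nat.exists_eq_add_of_le hk
  have e : 2 * (1 + m) - 1 = 2 * m + 1 := by omega
  rw [e, zpow_neg, zpow_natCast, inv_mul_eq_iff_eq_mul₀ (pow_ne_zero _ h), ← pow_mul, ← pow_add]
  congr 1
  ring

/-- Let `k ≥ 1`. Under `k`-times differentiability of `τ ↦ y₀ p τ` at `0` and
`1` and the `k`-th derivative equivariance
`(y₀ p)^{(k)}(1) = α^{2k-1} • R ((y₀ (φ⁻¹ p))^{(k)}(0))`, for every `j ≥ 1` and every `p`,
the `k`-th derivatives of the spliced pieces `y_j` and `y_{j-1}` agree at the junction time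
`τ_{j-1}`, and both equal `α^{(2k-1)j} • R^j ((y₀ (φ^{-j} p))^{(k)}(0))`.
Here `τ' j` denotes `τ_{j-1} = ∑_{k=0}^{j-1} α^{-2k}`. -/
theorem spliced_shrinking_breather_iteratedDeriv_junction
    {N : ℕ} (hN : 0 < N) {M : Type*} [Nonempty M]
    (φ : M ≃ M) (α : ℝ) (hα0 : 0 < α) (hα1 : α < 1)
    (R : EuclideanSpace ℝ (Fin N) ≃ₗᵢ[ℝ] EuclideanSpace ℝ (Fin N))
    (V : EuclideanSpace ℝ (Fin N))
    (y₀ : M → ℝ → EuclideanSpace ℝ (Fin N))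
    (hbreather : ∀ p : M, y₀ p 1 = α⁻¹ • R (y₀ (φ⁻¹ p) 0) + V)
    (τ' : ℕ → ℝ)
    (hτ' : ∀ j : ℕ, τ' j = ∑ k ∈ Finset.range j, α ^ (-(2 * k : ℤ)))
    (y : ℕ → M → ℝ → EuclideanSpace ℝ (Fin N))
    (hy : ∀ (j : ℕ) (p : M) (τ : ℝ), y j p τ =
      α ^ (-(j : ℤ)) • (R ^ j) (y₀ ((φ⁻¹ ^ j) p) (α ^ (2 * j) * (τ - τ' j))) +
      ∑ k ∈ Finset.range j, α ^ (-(k : ℤ)) • (R ^ k) V)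
    (k : ℕ) (hk : 1 ≤ k)
    (hdiff0 : ∀ p : M, ContDiffAt ℝ k (y₀ p) 0)
    (hdiff1 : ∀ p : M, ContDiffAt ℝ k (y₀ p) 1)
    (hequiv : ∀ p : M, iteratedDeriv k (y₀ p) 1 =
      α ^ (2 * k - 1) • R (iteratedDeriv k (y₀ (φ⁻¹ p)) 0)) :
    ∀ j : ℕ, 1 ≤ j → ∀ p : M,
      iteratedDeriv k (fun τ => y j p τ) (τ' j) =
        iteratedDeriv k (fun τ => y (j - 1) p τ) (τ' j) ∧
      iteratedDeriv k (fun τ => y j p τ) (τ' j) =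
        α ^ ((2 * k - 1) * j) • (R ^ j) (iteratedDeriv k (y₀ ((φ⁻¹ ^ j) p)) 0) := by
  intro j hj p
  have hne : α ≠ 0 := hα0.ne'
  have key : ∀ (j : ℕ) (t : ℝ), iteratedDeriv k (fun τ => y j p τ) t =
      α ^ ((2 * k - 1) * j) •
        (R ^ j) (iteratedDeriv k (y₀ ((φ⁻¹ ^ j) p)) (α ^ (2 * j) * (t - τ' j))) := by
    intro j t
    simp only [hy]
    rw [aux_piece k hk, aux_pow α hne k j hk]
  have h1 : iteratedDeriv k (fun τ => y j p τ) (τ' j) =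
        α ^ ((2 * k - 1) * j) • (R ^ j) (iteratedDeriv k (y₀ ((φ⁻¹ ^ j) p)) 0) := by
    rw [key, sub_self, mul_zero]
  refine ⟨?_, h1⟩
  rw [h1]
  obtain ⟨i, rfl⟩ := Nat.exists_eq_add_of_le' hj
  rw [Nat.add_sub_cancel, key]
  have ht : α ^ (2 * i) * (τ' (i + 1) - τ' i) = 1 := by
    rw [hτ', hτ', Finset.sum_range_succ, add_sub_cancel_left, zpow_neg]
    have : α ^ (2 * (i : ℤ)) = α ^ (2 * i) := by
      rw [← zpow_natCast]; push_cast; rfl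
    rw [this, mul_inv_cancel₀ (pow_ne_zero _ hne)]
  rw [ht, hequiv, map_smul, smul_smul, ← pow_add, Nat.mul_succ, pow_succ R, pow_succ' φ⁻¹]
  rfl
end

section
/- Assume additionally that for each p ∈ M the map τ ↦ y₀ p τ is continuous on [0,1], and set c₀ = (α^{-2} − 1)^{-1}. Then there exist a linear isometry R^∞ : E ≃ₗᵢ[ℝ] E, a vector V^∞ ∈ E, and a strictly increasing sequence of natural numbers (j_l) such that for every p ∈ M and every τ ∈ [1, α^{-2}], lim_{l→∞} τ_{j_l}^{-1/2} • y_{j_l+1} (φ^{j_l+1} p) (τ_{j_l} τ) = c₀^{-1/2} • R^∞ (y₀ p (c₀ (τ−1))) + V^∞. -/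
open Filter

lemma aux_subseq {N : ℕ} (α : ℝ) (hα0 : 0 < α) (hα1 : α < 1)
    (R : EuclideanSpace ℝ (Fin N) ≃ₗᵢ[ℝ] EuclideanSpace ℝ (Fin N))
    (V : EuclideanSpace ℝ (Fin N)) (w : ℕ → EuclideanSpace ℝ (Fin N))
    (hw : ∀ j, w j = α ^ j • ∑ k ∈ Finset.range j, α ^ (-(k : ℤ)) • (R ^ k) V) :
    ∃ (A : EuclideanSpace ℝ (Fin N) ≃ₗᵢ[ℝ] EuclideanSpace ℝ (Fin N))
      (W : EuclideanSpace ℝ (Fin N)) (jl : ℕ → ℕ), StrictMono jl ∧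
      (∀ (x : ℕ → EuclideanSpace ℝ (Fin N)) (x0 : EuclideanSpace ℝ (Fin N)),
        Tendsto x atTop (nhds x0) →
        Tendsto (fun l => (R ^ (jl l + 1)) (x l)) atTop (nhds (A x0))) ∧
      Tendsto (fun l => w (jl l + 1)) atTop (nhds W) := by
  have hwb : ∀ j, ‖w j‖ ≤ ‖V‖ / (1 - α) := by
    have h1 : 0 < 1 - α := by linarith
    intro j
    induction j with
    | zero => simp [hw]; positivity
    | succ j ih =>
      have e : w (j + 1) = α • w j + α • (R ^ j) V := by
        rw [hw (j + 1), hw j, Finset.sum_range_succ, smul_add, smul_smul, smul_smul]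
        congr 2
        · ring
        · rw [zpow_neg, zpow_natCast]
          field_simp
          ring
      rw [e]
      refine (norm_add_le _ _).trans ?_
      rw [norm_smul, norm_smul, LinearIsometryEquiv.norm_map, Real.norm_of_nonneg hα0.le]
      rw [le_div_iff₀ h1] at ih ⊢
      have hV := norm_nonneg V
      nlinarith [mul_le_mul_of_nonneg_left ih hα0.le, mul_nonneg hV (sq_nonneg (1 - α))]
  let L : ℕ → EuclideanSpace ℝ (Fin N) →L[ℝ] EuclideanSpace ℝ (Fin N) :=
    fun j => (R ^ (j + 1)).toContinuousLinearEquiv.toContinuousLinearMap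
  have hLa : ∀ j x, L j x = (R ^ (j + 1)) x := fun _ _ => rfl
  have hL : ∀ j, ‖L j‖ ≤ 1 := fun j =>
    ContinuousLinearMap.opNorm_le_bound _ zero_le_one (fun x => by
      rw [hLa, LinearIsometryEquiv.norm_map, one_mul])
  obtain ⟨B, -, f, hf, hB⟩ := tendsto_subseq_of_bounded
    (Metric.isBounded_closedBall (x := (0 : EuclideanSpace ℝ (Fin N) →L[ℝ] EuclideanSpace ℝ (Fin N))) (r := 1))
    (x := L) (fun n => by simpa using hL n)
  obtain ⟨W, -, g, hg, hW⟩ := tendsto_subseq_of_bounded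
    (Metric.isBounded_closedBall (x := (0 : EuclideanSpace ℝ (Fin N))) (r := ‖V‖ / (1 - α)))
    (x := fun n => w (f n + 1)) (fun n => by simpa using hwb _)
  have hB2 : Tendsto (fun l => L (f (g l))) atTop (nhds B) := hB.comp hg.tendsto_atTop
  have happ : ∀ (x : ℕ → EuclideanSpace ℝ (Fin N)) (x0 : EuclideanSpace ℝ (Fin N)),
        Tendsto x atTop (nhds x0) →
        Tendsto (fun l => L (f (g l)) (x l)) atTop (nhds (B x0)) :=
    fun x x0 hx =>
      ((isBoundedBilinearMap_apply (𝕜 := ℝ)).continuous.tendsto (B, x0)).comp (hB2.prodMk_nhds hx)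
  have hBn : ∀ x, ‖B x‖ = ‖x‖ := by
    intro x
    have h := (happ (fun _ => x) x tendsto_const_nhds).norm
    simp only [hLa, LinearIsometryEquiv.norm_map] at h
    exact tendsto_nhds_unique h tendsto_const_nhds
  let A0 : EuclideanSpace ℝ (Fin N) →ₗᵢ[ℝ] EuclideanSpace ℝ (Fin N) := ⟨B.toLinearMap, hBn⟩
  refine ⟨A0.toLinearIsometryEquiv rfl, W, f ∘ g, hf.comp hg, ?_, hW⟩
  intro x x0 hx
  exact happ x x0 hx

/-- If moreover `τ ↦ y₀ p τ` is continuous on `[0,1]` for each `p`, and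
`c₀ = (α^{-2} − 1)⁻¹`, then there exist a linear isometry `R^∞`, a vector `V^∞`, and a
strictly increasing sequence `(j_l)` of natural numbers such that for every `p ∈ M` and
every `τ ∈ [1, α^{-2}]`,
`τ_{j_l}^{-1/2} • y_{j_l+1} (φ^{j_l+1} p) (τ_{j_l} τ) → c₀^{-1/2} • R^∞ (y₀ p (c₀(τ−1))) + V^∞`.
Here `τ' j` denotes `τ_{j-1} = ∑_{k=0}^{j-1} α^{-2k}`, so `τ_j = τ' (j+1)`. -/
theorem blowdown_limit_shrinking_breather
    {N : ℕ} (hN : 0 < N) {M : Type*} [Nonempty M]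
    (φ : M ≃ M) (α : ℝ) (hα0 : 0 < α) (hα1 : α < 1)
    (R : EuclideanSpace ℝ (Fin N) ≃ₗᵢ[ℝ] EuclideanSpace ℝ (Fin N))
    (V : EuclideanSpace ℝ (Fin N))
    (y₀ : M → ℝ → EuclideanSpace ℝ (Fin N))
    (hbreather : ∀ p : M, y₀ p 1 = α⁻¹ • R (y₀ (φ⁻¹ p) 0) + V)
    (τ' : ℕ → ℝ)
    (hτ' : ∀ j : ℕ, τ' j = ∑ k ∈ Finset.range j, α ^ (-(2 * k : ℤ)))
    (y : ℕ → M → ℝ → EuclideanSpace ℝ (Fin N))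
    (hy : ∀ (j : ℕ) (p : M) (τ : ℝ), y j p τ =
      α ^ (-(j : ℤ)) • (R ^ j) (y₀ ((φ⁻¹ ^ j) p) (α ^ (2 * j) * (τ - τ' j))) +
      ∑ k ∈ Finset.range j, α ^ (-(k : ℤ)) • (R ^ k) V)
    (hcont : ∀ p : M, ContinuousOn (y₀ p) (Set.Icc 0 1))
    (c₀ : ℝ) (hc₀ : c₀ = (α ^ (-(2 : ℤ)) - 1)⁻¹) :
    ∃ (Rinf : EuclideanSpace ℝ (Fin N) ≃ₗᵢ[ℝ] EuclideanSpace ℝ (Fin N))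
      (Vinf : EuclideanSpace ℝ (Fin N)) (jl : ℕ → ℕ), StrictMono jl ∧
      ∀ (p : M) (τ : ℝ), τ ∈ Set.Icc 1 (α ^ (-(2 : ℤ))) →
        Tendsto (fun l : ℕ =>
            (Real.sqrt (τ' (jl l + 1)))⁻¹ •
              y (jl l + 1) ((φ ^ (jl l + 1)) p) (τ' (jl l + 1) * τ))
          atTop
          (nhds ((Real.sqrt c₀)⁻¹ • Rinf (y₀ p (c₀ * (τ - 1))) + Vinf)) := by
  classical
  have hα2 : 0 < α ^ 2 := by positivity
  have hα21 : α ^ 2 < 1 := by nlinarith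
  have hA : α ^ (-(2 : ℤ)) = (α ^ 2)⁻¹ := by
    rw [zpow_neg]; norm_cast
  have hinv : 1 < (α ^ 2)⁻¹ := (one_lt_inv₀ hα2).2 hα21
  rw [hA] at hc₀
  have hc0 : 0 < c₀ := by rw [hc₀]; exact inv_pos.2 (by linarith)
  have hcm : c₀ * ((α ^ 2)⁻¹ - 1) = 1 := by
    rw [hc₀]; exact inv_mul_cancel₀ (by linarith)
  have hq : ∀ j, α ^ (2 * j) * τ' j = c₀ * (1 - α ^ (2 * j)) := by
    intro j
    have h : τ' j = c₀ * ((α ^ (2 * j))⁻¹ - 1) := by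
      induction j with
      | zero => simp [hτ']
      | succ j ih =>
        rw [hτ', Finset.sum_range_succ, ← hτ', ih]
        have e1 : α ^ (-(2 * (j : ℤ))) = (α ^ (2 * j))⁻¹ := by
          rw [zpow_neg]; norm_cast
        have e2 : (α ^ (2 * (j + 1)))⁻¹ = (α ^ (2 * j))⁻¹ * (α ^ 2)⁻¹ := by
          rw [← mul_inv]; ring
        rw [e1, e2]
        linear_combination (-(α ^ (2 * j))⁻¹) * hcm
    rw [h]
    have : α ^ (2 * j) ≠ 0 := by positivity
    field_simp
  obtain ⟨A, W, jl, hjl, hR, hW⟩ := aux_subseq α hα0 hα1 R V _ (fun j => rfl)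
  refine ⟨A, (Real.sqrt c₀)⁻¹ • W, jl, hjl, ?_⟩
  intro p τ hτ
  rw [hA] at hτ
  have hpow : Tendsto (fun l => α ^ (2 * (jl l + 1))) atTop (nhds 0) := by
    have h1 : Tendsto (fun l => 2 * (jl l + 1)) atTop atTop :=
      tendsto_atTop_mono (fun l => by have := hjl.id_le l; simp only [id] at this ⊢; omega) tendsto_id
    exact (tendsto_pow_atTop_nhds_zero_of_lt_one hα0.le hα1).comp h1
  have hqt : Tendsto (fun l => c₀ * (1 - α ^ (2 * (jl l + 1)))) atTop (nhds c₀) := by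
    simpa using (hpow.const_sub 1).const_mul c₀
  have hst := (hqt.sqrt).inv₀ (Real.sqrt_pos.2 hc0).ne'
  have hmem : c₀ * (τ - 1) ∈ Set.Icc (0 : ℝ) 1 := by
    constructor
    · exact mul_nonneg hc0.le (by linarith [hτ.1])
    · rw [← hcm]; exact mul_le_mul_of_nonneg_left (by linarith [hτ.2]) hc0.le
  have hyt : Tendsto (fun l => y₀ p (c₀ * (1 - α ^ (2 * (jl l + 1))) * (τ - 1))) atTop
      (nhds (y₀ p (c₀ * (τ - 1)))) := by
    refine (hcont p _ hmem).tendsto.comp (tendsto_nhdsWithin_iff.2 ⟨hqt.mul_const _, ?_⟩)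
    refine Eventually.of_forall fun l => ?_
    have h0 : 0 < α ^ (2 * (jl l + 1)) := by positivity
    have h1 : α ^ (2 * (jl l + 1)) ≤ 1 := pow_le_one₀ hα0.le hα1.le
    have e : c₀ * (1 - α ^ (2 * (jl l + 1))) * (τ - 1)
      = (1 - α ^ (2 * (jl l + 1))) * (c₀ * (τ - 1)) := by ring
    rw [e]
    exact ⟨mul_nonneg (by linarith) hmem.1, mul_le_one₀ (by linarith) hmem.1 hmem.2⟩
  have hfin := hst.smul ((hR _ _ hyt).add hW)
  rw [smul_add] at hfin
  refine hfin.congr fun l => ?_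
  generalize jl l + 1 = j
  have hφ : (φ⁻¹ ^ j) ((φ ^ j) p) = p := by
    rw [inv_pow]; exact Equiv.symm_apply_apply _ _
  have harg : α ^ (2 * j) * (τ' j * τ - τ' j) = c₀ * (1 - α ^ (2 * j)) * (τ - 1) := by
    rw [← hq]; ring
  have hs : Real.sqrt (c₀ * (1 - α ^ (2 * j))) = α ^ j * Real.sqrt (τ' j) := by
    rw [← hq, Real.sqrt_mul (by positivity), mul_comm 2 j, pow_mul, Real.sqrt_sq (by positivity)]
  have hne : α ^ j ≠ 0 := by positivity
  rw [hy, hφ, harg, hs, smul_add, smul_add, smul_smul, smul_smul, zpow_neg, zpow_natCast, mul_inv]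
  congr 2
  · ring
  · rw [mul_comm, ← mul_assoc, mul_inv_cancel₀ hne, one_mul]
end

section
/- For every ε > 0 there exists a constant C > 0, depending only on n, α, c₀ and ε, such that for every integer j ≥ 1, every τ̃ ∈ [0,1], every linear isometry R : E ≃ₗᵢ[ℝ] E, every a ∈ E, and every v ∈ E with ‖v‖ ≤ c₀, the following Gaussian kernel comparison holds: α^{-nj} · (4π(α^{-2j} τ̃ + τ_{j-1}))^{-n/2} · exp(−‖α^{-j} • (R a + v)‖² / (4(α^{-2j} τ̃ + τ_{j-1}))) ≤ C · (4π(τ̃ + τ₀ + ε))^{-n/2} · exp(−‖a‖² / (4(τ̃ + τ₀ + ε))). -/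
/-- Gaussian kernel comparison. With `τ₀ = (α^{-2}−1)⁻¹` and
`τ_{j-1} = ∑_{k=0}^{j-1} α^{-2k}` for `j ≥ 1`, and `c₀ > 0` fixed: for every `ε > 0` there
is `C > 0` (depending only on `n`, `α`, `c₀`, `ε`) such that for every `j ≥ 1`, every
`t ∈ [0,1]`, every linear isometry `R`, every `a`, and every `v` with `‖v‖ ≤ c₀`,
`α^{-nj} (4π(α^{-2j}t+τ_{j-1}))^{-n/2} exp(−‖α^{-j}•(Ra+v)‖²/(4(α^{-2j}t+τ_{j-1})))
  ≤ C (4π(t+τ₀+ε))^{-n/2} exp(−‖a‖²/(4(t+τ₀+ε)))`. -/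
theorem gaussian_kernel_comparison
    {n N : ℕ} (hn : 0 < n) (hN : 0 < N) (α : ℝ) (hα0 : 0 < α) (hα1 : α < 1)
    (τ₀ : ℝ) (hτ₀ : τ₀ = (α ^ (-(2 : ℤ)) - 1)⁻¹)
    (τ' : ℕ → ℝ)
    (hτ' : ∀ j : ℕ, τ' j = ∑ k ∈ Finset.range j, α ^ (-(2 * k : ℤ)))
    (c₀ : ℝ) (hc₀ : 0 < c₀) :
    ∀ ε : ℝ, 0 < ε → ∃ C : ℝ, 0 < C ∧
      ∀ (j : ℕ), 1 ≤ j → ∀ t : ℝ, t ∈ Set.Icc (0 : ℝ) 1 →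
      ∀ (R : EuclideanSpace ℝ (Fin N) ≃ₗᵢ[ℝ] EuclideanSpace ℝ (Fin N))
        (a v : EuclideanSpace ℝ (Fin N)), ‖v‖ ≤ c₀ →
        α ^ (-(n * j : ℤ)) *
            (4 * Real.pi * (α ^ (-(2 * j : ℤ)) * t + τ' j)) ^ (-(n : ℝ) / 2) *
            Real.exp (-‖α ^ (-(j : ℤ)) • (R a + v)‖ ^ 2 /
              (4 * (α ^ (-(2 * j : ℤ)) * t + τ' j))) ≤
          C * (4 * Real.pi * (t + τ₀ + ε)) ^ (-(n : ℝ) / 2) *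
            Real.exp (-‖a‖ ^ 2 / (4 * (t + τ₀ + ε))) := by
  intro ε hε
  have hα2 : 0 < 1 - α ^ 2 := by nlinarith
  have hτ0 : τ₀ = α ^ 2 / (1 - α ^ 2) := by
    rw [hτ₀, zpow_neg]
    have : (α ^ (2:ℤ)) = α ^ 2 := by norm_cast
    rw [this]
    have h3 : (α ^ 2)⁻¹ - 1 = (1 - α ^ 2) / α ^ 2 := by field_simp
    rw [h3, inv_div]
  have hτ0pos : 0 < τ₀ := by rw [hτ0]; positivity
  have hM : 0 < 1 + τ₀ + ε := by positivity
  have hpi := Real.pi_pos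
  refine ⟨(4 * Real.pi * α ^ 2) ^ (-(n : ℝ) / 2) / (4 * Real.pi * (1 + τ₀ + ε)) ^ (-(n : ℝ) / 2)
    * Real.exp (c₀ ^ 2 / (4 * ε)), by positivity, ?_⟩
  intro j hj t ht R a v hv
  obtain ⟨ht0, ht1⟩ := ht
  -- the rescaled time
  have hS : α ^ (2 * j) * τ' j = τ₀ * (1 - α ^ (2 * j)) := by
    clear hj
    have key : ∀ j, α ^ (2 * j) * τ' j = τ₀ * (1 - α ^ (2 * j)) := by
      intro j
      induction j with
      | zero => simp [hτ']
      | succ k ih =>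
        have h1 : τ' (k + 1) = τ' k + α ^ (-(2 * k : ℤ)) := by
          rw [hτ', hτ', Finset.sum_range_succ]
        have h2 : α ^ (2 * k) * α ^ (-(2 * k : ℤ)) = 1 := by
          have : α ^ (2 * k) = α ^ (2 * k : ℤ) := by norm_cast
          rw [this, ← zpow_add₀ hα0.ne']; simp
        have h4 : τ₀ * (1 - α ^ 2) = α ^ 2 := by rw [hτ0]; field_simp
        have e : α ^ (2 * (k + 1)) = α ^ (2 * k) * α ^ 2 := by ring
        rw [h1, e]
        linear_combination α ^ 2 * ih + α ^ 2 * h2 - h4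
    exact key j
  have hqpos : 0 < α ^ (2 * j) := by positivity
  have hq : α ^ (2 * j) ≤ α ^ 2 := pow_le_pow_of_le_one hα0.le hα1.le (by omega)
  have hb : α ^ j ≠ 0 := by positivity
  obtain ⟨s, hs⟩ : ∃ s, s = t + α ^ (2 * j) * τ' j := ⟨_, rfl⟩
  have hs_low : α ^ 2 ≤ s := by
    have h4 : τ₀ * (1 - α ^ 2) = α ^ 2 := by rw [hτ0]; field_simp
    have : τ₀ * (1 - α ^ 2) ≤ τ₀ * (1 - α ^ (2 * j)) := by gcongr
    rw [hs, hS]; linarith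
  have hs_pos : 0 < s := lt_of_lt_of_le (by positivity) hs_low
  have hs_up : s + ε ≤ t + τ₀ + ε := by
    rw [hs, hS]; nlinarith
  have hSs : α ^ (-(2 * j : ℤ)) * t + τ' j = (α ^ j)⁻¹ ^ 2 * s := by
    have : α ^ (-(2 * j : ℤ)) = (α ^ j)⁻¹ ^ 2 := by
      rw [zpow_neg, inv_pow, ← pow_mul, mul_comm j 2]; norm_cast
    rw [this, hs, mul_comm 2 j, pow_mul]; field_simp
  have hαn : α ^ (-(n * j : ℤ)) = ((α ^ j)⁻¹) ^ n := by
    rw [zpow_neg, inv_pow, ← pow_mul, mul_comm j n]; norm_cast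
  have hαj : α ^ (-(j : ℤ)) = (α ^ j)⁻¹ := by
    rw [zpow_neg]; norm_cast
  rw [hSs, hαn, hαj]
  obtain ⟨b, hbdef⟩ : ∃ b, b = (α ^ j)⁻¹ := ⟨_, rfl⟩
  have hbpos : 0 < b := by rw [hbdef]; positivity
  rw [← hbdef]
  have hpre : b ^ n * (4 * Real.pi * (b ^ 2 * s)) ^ (-(n : ℝ) / 2)
      = (4 * Real.pi * s) ^ (-(n : ℝ) / 2) := by
    have e : 4 * Real.pi * (b ^ 2 * s) = b ^ 2 * (4 * Real.pi * s) := by ring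
    rw [e, Real.mul_rpow (by positivity) (by positivity)]
    have : (b ^ 2) ^ (-(n : ℝ) / 2) = (b ^ n)⁻¹ := by
      rw [← Real.rpow_natCast b 2, ← Real.rpow_mul hbpos.le, ← Real.rpow_natCast b n,
        ← Real.rpow_neg hbpos.le]
      congr 1; push_cast; ring
    rw [this, ← mul_assoc, mul_inv_cancel₀ (by positivity), one_mul]
  have hexp : -‖b • (R a + v)‖ ^ 2 / (4 * (b ^ 2 * s)) = -‖R a + v‖ ^ 2 / (4 * s) := by
    rw [norm_smul, Real.norm_of_nonneg hbpos.le]; field_simp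
  rw [hpre, hexp]
  have hT : 0 < t + τ₀ + ε := by positivity
  have hneg : -(n : ℝ) / 2 ≤ 0 := by
    have : (0:ℝ) ≤ n := by positivity
    linarith
  have h1 : (4 * Real.pi * s) ^ (-(n : ℝ) / 2) ≤ (4 * Real.pi * α ^ 2) ^ (-(n : ℝ) / 2) :=
    Real.rpow_le_rpow_of_nonpos (by positivity) (by gcongr) hneg
  have h2 : (4 * Real.pi * (1 + τ₀ + ε)) ^ (-(n : ℝ) / 2)
      ≤ (4 * Real.pi * (t + τ₀ + ε)) ^ (-(n : ℝ) / 2) :=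
    Real.rpow_le_rpow_of_nonpos (by positivity) (by gcongr) hneg
  have hna : ‖a‖ ≤ ‖R a + v‖ + c₀ := by
    have h := norm_sub_le (R a + v) v
    rw [add_sub_cancel_right, R.norm_map] at h
    linarith
  have h3 : Real.exp (-‖R a + v‖ ^ 2 / (4 * s)) ≤
      Real.exp (c₀ ^ 2 / (4 * ε)) * Real.exp (-‖a‖ ^ 2 / (4 * (t + τ₀ + ε))) := by
    rw [← Real.exp_add]
    apply Real.exp_le_exp.mpr
    obtain ⟨x, hx⟩ : ∃ x, x = ‖R a + v‖ := ⟨_, rfl⟩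
    rw [← hx] at hna ⊢
    have e1 : ‖a‖ ^ 2 / (4 * (t + τ₀ + ε)) ≤ (x + c₀) ^ 2 / (4 * (s + ε)) := by
      gcongr
    have e2 : x ^ 2 / (4 * s) + c₀ ^ 2 / (4 * ε) - (x + c₀) ^ 2 / (4 * (s + ε))
        = (x * ε - c₀ * s) ^ 2 / (4 * (s * ε * (s + ε))) := by
      have : s + ε ≠ 0 := by positivity
      field_simp
      ring
    have e3 : 0 ≤ (x * ε - c₀ * s) ^ 2 / (4 * (s * ε * (s + ε))) := by positivity
    rw [neg_div, neg_div]
    linarith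
  have hP : 0 < (4 * Real.pi * (1 + τ₀ + ε)) ^ (-(n : ℝ) / 2) := by positivity
  have h4 : (4 * Real.pi * s) ^ (-(n : ℝ) / 2) ≤
      (4 * Real.pi * α ^ 2) ^ (-(n : ℝ) / 2) / (4 * Real.pi * (1 + τ₀ + ε)) ^ (-(n : ℝ) / 2)
        * (4 * Real.pi * (t + τ₀ + ε)) ^ (-(n : ℝ) / 2) := by
    refine h1.trans ?_
    rw [div_mul_eq_mul_div, le_div_iff₀ hP]
    gcongr
  calc _ ≤ _ := mul_le_mul h4 h3 (by positivity) (by positivity)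
    _ = _ := by ring
end

section
/- For every integer j ≥ 1 and every p ∈ M, the spliced pieces of the expanding breather agree at the junction time: x_j p t_{j-1} = x_{j-1} p t_{j-1}. -/
/-- For every integer `j ≥ 1` and every `p ∈ M`, the spliced pieces of the
expanding breather agree at the junction time: `x_j p t_{j-1} = x_{j-1} p t_{j-1}`.
Here `t' j` denotes `t_{j-1} = ∑_{k=0}^{j-1} α^{2k}` (so `t' 0 = 0`). -/
theorem spliced_expanding_breather_junction
    {N : ℕ} (hN : 0 < N) {M : Type*} [Nonempty M]
    (φ : M ≃ M) (α : ℝ) (hα : 1 < α)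
    (R : EuclideanSpace ℝ (Fin N) ≃ₗᵢ[ℝ] EuclideanSpace ℝ (Fin N))
    (V : EuclideanSpace ℝ (Fin N))
    (x₀ : M → ℝ → EuclideanSpace ℝ (Fin N))
    (hbreather : ∀ p : M, x₀ p 1 = α • R (x₀ (φ p) 0) + V)
    (t' : ℕ → ℝ)
    (ht' : ∀ j : ℕ, t' j = ∑ k ∈ Finset.range j, α ^ (2 * k))
    (x : ℕ → M → ℝ → EuclideanSpace ℝ (Fin N))
    (hx : ∀ (j : ℕ) (p : M) (t : ℝ), x j p t =
      α ^ j • (R ^ j) (x₀ ((φ ^ j) p) (α ^ (-(2 * j : ℤ)) * (t - t' j))) +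
      ∑ k ∈ Finset.range j, α ^ k • (R ^ k) V) :
    ∀ j : ℕ, 1 ≤ j → ∀ p : M, x j p (t' j) = x (j - 1) p (t' j) := by
  intro j hj p
  obtain ⟨n, rfl⟩ : ∃ n, j = n + 1 := ⟨j - 1, by omega⟩
  have hα0 : α ≠ 0 := by linarith
  have h1 : t' (n + 1) - t' n = α ^ (2 * n) := by
    rw [ht', ht', Finset.sum_range_succ]; ring
  have h2 : α ^ (-(2 * (n : ℤ))) * α ^ (2 * n) = 1 := by
    have h3 : α ^ (2 * n) = α ^ (2 * (n : ℤ)) := by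
      rw [← zpow_natCast]; push_cast; rfl
    rw [h3, ← zpow_add₀ hα0]; simp
  have hR : ∀ v, (R ^ (n + 1)) v = (R ^ n) (R v) := fun v => by
    rw [pow_succ]; rfl
  have hφ : (φ ^ (n + 1)) p = φ ((φ ^ n) p) := by
    rw [pow_succ']; rfl
  rw [hx, hx, Nat.add_sub_cancel, h1, h2, sub_self, mul_zero, hbreather, hR, hφ,
    Finset.sum_range_succ, map_add, map_smul, smul_add, smul_smul, ← pow_succ]
  abel
end

section
/- Assume additionally that for each p ∈ M the map t ↦ x₀ p t is continuous on [0,1], and set c₀ = (α² − 1)^{-1}. Then there exist a linear isometry R^∞ : E ≃ₗᵢ[ℝ] E, a vector V^∞ ∈ E, and a strictly increasing sequence of natural numbers (j_l) such that for every p ∈ M and every t ∈ [1, α²], lim_{l→∞} t_{j_l}^{-1/2} • x_{j_l+1} (φ^{-(j_l+1)} p) (t_{j_l} t) = c₀^{-1/2} • R^∞ (x₀ p (c₀ (t−1))) + V^∞. -/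
open Filter

/-- If moreover `t ↦ x₀ p t` is continuous on `[0,1]` for each `p`, and
`c₀ = (α² − 1)⁻¹`, then there exist a linear isometry `R^∞`, a vector `V^∞`, and a strictly
increasing sequence `(j_l)` of natural numbers such that for every `p ∈ M` and every
`t ∈ [1, α²]`,
`t_{j_l}^{-1/2} • x_{j_l+1} (φ^{-(j_l+1)} p) (t_{j_l} t) → c₀^{-1/2} • R^∞ (x₀ p (c₀(t−1))) + V^∞`.
Here `t' j` denotes `t_{j-1} = ∑_{k=0}^{j-1} α^{2k}`, so `t_j = t' (j+1)`. -/
theorem blowdown_limit_expanding_breather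
    {N : ℕ} (hN : 0 < N) {M : Type*} [Nonempty M]
    (φ : M ≃ M) (α : ℝ) (hα : 1 < α)
    (R : EuclideanSpace ℝ (Fin N) ≃ₗᵢ[ℝ] EuclideanSpace ℝ (Fin N))
    (V : EuclideanSpace ℝ (Fin N))
    (x₀ : M → ℝ → EuclideanSpace ℝ (Fin N))
    (hbreather : ∀ p : M, x₀ p 1 = α • R (x₀ (φ p) 0) + V)
    (t' : ℕ → ℝ)
    (ht' : ∀ j : ℕ, t' j = ∑ k ∈ Finset.range j, α ^ (2 * k))
    (x : ℕ → M → ℝ → EuclideanSpace ℝ (Fin N))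
    (hx : ∀ (j : ℕ) (p : M) (t : ℝ), x j p t =
      α ^ j • (R ^ j) (x₀ ((φ ^ j) p) (α ^ (-(2 * j : ℤ)) * (t - t' j))) +
      ∑ k ∈ Finset.range j, α ^ k • (R ^ k) V)
    (hcont : ∀ p : M, ContinuousOn (x₀ p) (Set.Icc 0 1))
    (c₀ : ℝ) (hc₀ : c₀ = (α ^ 2 - 1)⁻¹) :
    ∃ (Rinf : EuclideanSpace ℝ (Fin N) ≃ₗᵢ[ℝ] EuclideanSpace ℝ (Fin N))
      (Vinf : EuclideanSpace ℝ (Fin N)) (jl : ℕ → ℕ), StrictMono jl ∧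
      ∀ (p : M) (t : ℝ), t ∈ Set.Icc 1 (α ^ 2) →
        Tendsto (fun l : ℕ =>
            (Real.sqrt (t' (jl l + 1)))⁻¹ •
              x (jl l + 1) ((φ⁻¹ ^ (jl l + 1)) p) (t' (jl l + 1) * t))
          atTop
          (nhds ((Real.sqrt c₀)⁻¹ • Rinf (x₀ p (c₀ * (t - 1))) + Vinf)) := by
  have hα0 : 0 < α := by linarith
  have hα2 : 0 < α ^ 2 - 1 := by nlinarith
  have hc₀pos : 0 < c₀ := by rw [hc₀]; positivity
  -- the normalised time factor
  have hs : ∀ n : ℕ, (α ^ n)⁻¹ ^ 2 * t' n = (1 - (α⁻¹ ^ 2) ^ n) * c₀ := by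
    intro n
    have h1 : t' n * (α ^ 2 - 1) = (α ^ 2) ^ n - 1 := by
      rw [ht']
      simp_rw [pow_mul]
      exact geom_sum_mul _ _
    have h2 : t' n = ((α ^ 2) ^ n - 1) * c₀ := by
      rw [hc₀, ← h1]; field_simp
    rw [h2]
    have : (α ^ n)⁻¹ ^ 2 = ((α ^ 2) ^ n)⁻¹ := by
      rw [inv_pow, ← pow_mul, ← pow_mul, mul_comm]
    have hq : (α ^ 2) ^ n ≠ 0 := by positivity
    rw [this, inv_pow α 2, inv_pow (α ^ 2) n, ← mul_assoc, mul_sub, inv_mul_cancel₀ hq, mul_one]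
  have hslim : Tendsto (fun n : ℕ => (α ^ n)⁻¹ ^ 2 * t' n) atTop (nhds c₀) := by
    simp_rw [hs]
    have : Tendsto (fun n : ℕ => (α⁻¹ ^ 2) ^ n) atTop (nhds 0) := by
      apply tendsto_pow_atTop_nhds_zero_of_lt_one (by positivity)
      exact pow_lt_one₀ (by positivity) (inv_lt_one_of_one_lt₀ hα) (by norm_num)
    simpa using (this.const_sub 1).mul_const c₀
  have hble : ∀ n : ℕ, (α ^ n)⁻¹ ^ 2 * t' n ≤ c₀ := by
    intro n
    rw [hs]
    have : 0 ≤ (α⁻¹ ^ 2) ^ n := by positivity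
    nlinarith
  have ht0 : ∀ n : ℕ, 0 ≤ t' n := by
    intro n; rw [ht']; positivity
  have hb : Tendsto (fun n : ℕ => (Real.sqrt (t' n))⁻¹ * α ^ n) atTop
      (nhds (Real.sqrt c₀)⁻¹) := by
    have h := ((Real.continuous_sqrt.tendsto c₀).comp hslim).inv₀
      (Real.sqrt_pos.2 hc₀pos).ne'
    refine h.congr fun n => ?_
    have hp : 0 < α ^ n := by positivity
    simp only [Function.comp]
    rw [Real.sqrt_mul (by positivity), Real.sqrt_sq (by positivity), mul_inv, inv_inv, mul_comm]
  -- the normalised translation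
  set w : ℕ → EuclideanSpace ℝ (Fin N) := fun n =>
    (α ^ n)⁻¹ • ∑ k ∈ Finset.range n, α ^ k • (R ^ k) V with hw
  have hwb : ∀ n, ‖w n‖ ≤ (α - 1)⁻¹ * ‖V‖ := by
    intro n
    have hp : 0 < α ^ n := by positivity
    have h1 : ‖∑ k ∈ Finset.range n, α ^ k • (R ^ k) V‖ ≤
        ∑ k ∈ Finset.range n, α ^ k * ‖V‖ := by
      refine norm_sum_le_of_le _ fun k _ => ?_
      rw [norm_smul, LinearIsometryEquiv.norm_map, Real.norm_of_nonneg (by positivity)]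
    rw [hw]
    simp only
    rw [norm_smul, Real.norm_of_nonneg (by positivity), inv_mul_le_iff₀ hp]
    refine h1.trans ?_
    rw [← Finset.sum_mul, ← mul_assoc]
    refine mul_le_mul_of_nonneg_right ?_ (norm_nonneg _)
    rw [geom_sum_eq hα.ne', div_eq_mul_inv]
    have : 0 < (α - 1)⁻¹ := inv_pos.2 (by linarith)
    nlinarith
  let Rc : ℕ → (EuclideanSpace ℝ (Fin N) →L[ℝ] EuclideanSpace ℝ (Fin N)) := fun n =>
    (R ^ n).toLinearIsometry.toContinuousLinearMap
  have hRc : ∀ n v, Rc n v = (R ^ n) v := fun n v => rfl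
  have hRb : ∀ n, ‖Rc n‖ ≤ 1 := fun n =>
    LinearIsometry.norm_toContinuousLinearMap_le _
  obtain ⟨⟨A, W⟩, -, ψ, hψ, hlim⟩ := tendsto_subseq_of_bounded
    (s := Metric.closedBall (0 : EuclideanSpace ℝ (Fin N) →L[ℝ] EuclideanSpace ℝ (Fin N)) 1 ×ˢ
      Metric.closedBall (0 : EuclideanSpace ℝ (Fin N)) ((α - 1)⁻¹ * ‖V‖))
    (Metric.isBounded_closedBall.prod Metric.isBounded_closedBall)
    (x := fun n => (Rc (n + 1), w (n + 1)))
    (fun n => ⟨by simpa using hRb (n + 1), by simpa using hwb (n + 1)⟩)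
  have hA : Tendsto (fun l => Rc (ψ l + 1)) atTop (nhds A) :=
    (continuous_fst.tendsto _).comp hlim
  have hW : Tendsto (fun l => w (ψ l + 1)) atTop (nhds W) :=
    (continuous_snd.tendsto _).comp hlim
  have happ : ∀ (y : ℕ → EuclideanSpace ℝ (Fin N)) (z : EuclideanSpace ℝ (Fin N)),
      Tendsto y atTop (nhds z) → Tendsto (fun l => Rc (ψ l + 1) (y l)) atTop (nhds (A z)) := by
    intro y z hyz
    exact ((isBoundedBilinearMap_apply (𝕜 := ℝ) (E := EuclideanSpace ℝ (Fin N))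
      (F := EuclideanSpace ℝ (Fin N))).continuous.tendsto (A, z)).comp (hA.prodMk_nhds hyz)
  have hiso : ∀ v, ‖A v‖ = ‖v‖ := by
    intro v
    have h := (happ _ _ (tendsto_const_nhds (x := v))).norm
    refine tendsto_nhds_unique h ?_
    simp only [hRc, LinearIsometryEquiv.norm_map]
    exact tendsto_const_nhds
  let Ai : EuclideanSpace ℝ (Fin N) →ₗᵢ[ℝ] EuclideanSpace ℝ (Fin N) := ⟨A.toLinearMap, hiso⟩
  have hψ1 : Tendsto (fun l => ψ l + 1) atTop atTop :=
    (tendsto_add_atTop_nat 1).comp hψ.tendsto_atTop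
  refine ⟨Ai.toLinearIsometryEquiv rfl, (Real.sqrt c₀)⁻¹ • W, ψ, hψ, fun p t ht => ?_⟩
  have hAi : (Ai.toLinearIsometryEquiv rfl) (x₀ p (c₀ * (t - 1))) = A (x₀ p (c₀ * (t - 1))) := rfl
  rw [hAi, ← smul_add]
  have ht1 : 0 ≤ t - 1 := by linarith [ht.1]
  have hc1 : c₀ * (t - 1) ≤ 1 := by
    rw [hc₀, inv_mul_le_iff₀ hα2]; linarith [ht.2]
  have hy : Tendsto (fun l => x₀ p ((α ^ (ψ l + 1))⁻¹ ^ 2 * t' (ψ l + 1) * (t - 1))) atTop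
      (nhds (x₀ p (c₀ * (t - 1)))) := by
    have hc := hcont p (c₀ * (t - 1)) ⟨by positivity, hc1⟩
    refine hc.tendsto.comp (tendsto_nhdsWithin_iff.2 ⟨?_, Eventually.of_forall fun l => ⟨?_, ?_⟩⟩)
    · exact (hslim.comp hψ1).mul_const _
    · have := ht0 (ψ l + 1)
      positivity
    · exact (mul_le_mul_of_nonneg_right (hble _) ht1).trans hc1
  refine ((hb.comp hψ1).smul ((happ _ _ hy).add hW)).congr fun l => ?_
  simp only [Function.comp]
  generalize ψ l + 1 = n
  have hp : α ^ n ≠ 0 := by positivity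
  have h1 : (φ ^ n) ((φ⁻¹ ^ n) p) = p := by
    rw [inv_pow]
    exact Equiv.apply_symm_apply (φ ^ n) p
  have h2 : α ^ (-(2 * n : ℤ)) = (α ^ n)⁻¹ ^ 2 := by
    rw [zpow_neg, inv_pow, ← pow_mul, mul_comm n 2]
    norm_cast
  rw [hx, h1, h2, hRc, mul_smul, hw]
  simp only
  rw [smul_add (α ^ n), smul_smul (α ^ n) (α ^ n)⁻¹, mul_inv_cancel₀ hp, one_smul]
  congr 5
  ring
end

section
/- Let n ≥ 1, E = EuclideanSpace ℝ (Fin (n+1)), let M be a smooth n-dimensional manifold without boundary, and let f : M → E be a smooth map. Suppose p₀ ∈ M is a local minimum of the function p ↦ ‖f p‖ and that the differential mfderiv f p₀ : T_{p₀}M → E is injective. Let J : E →ₗ[ℝ] E be skew-adjoint, i.e. ⟪J x, y⟫ = −⟪x, J y⟫ for all x, y ∈ E. Then for every vector ν ∈ E orthogonal to the range of mfderiv f p₀, one has ⟪J (f p₀), ν⟫ = 0. -/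
open scoped Manifold RealInnerProductSpace

theorem aux_linear {n : ℕ}
    (L : EuclideanSpace ℝ (Fin n) →L[ℝ] EuclideanSpace ℝ (Fin (n + 1)))
    (hL : Function.Injective L)
    (J : EuclideanSpace ℝ (Fin (n + 1)) →ₗ[ℝ] EuclideanSpace ℝ (Fin (n + 1)))
    (hJ : ∀ x y : EuclideanSpace ℝ (Fin (n + 1)), ⟪J x, y⟫ = -⟪x, J y⟫)
    (x ν : EuclideanSpace ℝ (Fin (n + 1)))
    (hx : ∀ v, ⟪L v, x⟫ = 0) (hν : ∀ v, ⟪L v, ν⟫ = 0) : ⟪J x, ν⟫ = 0 := by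
  let K := LinearMap.range (L : EuclideanSpace ℝ (Fin n) →ₗ[ℝ] EuclideanSpace ℝ (Fin (n + 1)))
  have h1 : Module.finrank ℝ K = n := by
    have := LinearMap.finrank_range_of_inj
      (f := (L : EuclideanSpace ℝ (Fin n) →ₗ[ℝ] EuclideanSpace ℝ (Fin (n + 1)))) hL
    simpa using this
  have h2 : Module.finrank ℝ Kᗮ = 1 := by
    have := K.finrank_add_finrank_orthogonal
    rw [h1] at this
    simpa using this
  have mem : ∀ y, (∀ v, ⟪L v, y⟫ = 0) → y ∈ Kᗮ := by
    intro y hy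
    rw [Submodule.mem_orthogonal]
    rintro _ ⟨v, rfl⟩
    exact hy v
  obtain ⟨u, hu⟩ := finrank_le_one_iff.mp h2.le
  obtain ⟨a, ha⟩ := hu ⟨x, mem x hx⟩
  obtain ⟨b, hb⟩ := hu ⟨ν, mem ν hν⟩
  have ha' : x = a • (u : EuclideanSpace ℝ (Fin (n + 1))) := (congrArg Subtype.val ha).symm
  have hb' : ν = b • (u : EuclideanSpace ℝ (Fin (n + 1))) := (congrArg Subtype.val hb).symm
  have h0 := hJ u u
  rw [real_inner_comm (J u) (u : EuclideanSpace ℝ (Fin (n + 1)))] at h0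
  have h0' : ⟪J u, (u : EuclideanSpace ℝ (Fin (n + 1)))⟫ = 0 := by
    have h3 := real_inner_comm (J u) (u : EuclideanSpace ℝ (Fin (n + 1)))
    linarith
  rw [ha', hb', map_smul, real_inner_smul_left, real_inner_smul_right, h0']
  simp

theorem aux_crit {E F : Type*} [NormedAddCommGroup E] [NormedSpace ℝ E]
    [NormedAddCommGroup F] [InnerProductSpace ℝ F] (g : E → F) (L : E →L[ℝ] F) (y : E)
    (hg : HasFDerivAt g L y) (hmin : IsLocalMin (fun z => ‖g z‖) y) (v : E) :
    ⟪L v, g y⟫ = 0 := by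
  have h1 : IsLocalMin (fun z => ‖g z‖ ^ 2) y := by
    filter_upwards [hmin] with z hz
    exact pow_le_pow_left₀ (norm_nonneg _) hz 2
  have h2 := h1.hasFDerivAt_eq_zero hg.norm_sq
  have h3 := congrArg (fun T => T v) h2
  simp at h3
  rw [real_inner_comm]
  exact h3

/-- Let `M` be a smooth `n`-manifold without boundary (`n ≥ 1`) and
`f : M → ℝ^{n+1}` a smooth map. If `p₀` is a local minimum of `p ↦ ‖f p‖` with injective
differential `mfderiv f p₀`, and `J` is skew-adjoint, then `⟪J (f p₀), ν⟫ = 0` for every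
`ν` orthogonal to the range of `mfderiv f p₀`. -/
theorem rotator_mean_curvature_vanishes_at_closest_point
    {n : ℕ} (hn : 1 ≤ n)
    {M : Type*} [TopologicalSpace M] [ChartedSpace (EuclideanSpace ℝ (Fin n)) M]
    [IsManifold (𝓡 n) (⊤ : ℕ∞) M]
    (f : M → EuclideanSpace ℝ (Fin (n + 1)))
    (hf : ContMDiff (𝓡 n) 𝓘(ℝ, EuclideanSpace ℝ (Fin (n + 1))) (⊤ : ℕ∞) f)
    (p₀ : M) (hmin : IsLocalMin (fun p => ‖f p‖) p₀)
    (hinj : Function.Injective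
      (mfderiv (𝓡 n) 𝓘(ℝ, EuclideanSpace ℝ (Fin (n + 1))) f p₀))
    (J : EuclideanSpace ℝ (Fin (n + 1)) →ₗ[ℝ] EuclideanSpace ℝ (Fin (n + 1)))
    (hJ : ∀ x y : EuclideanSpace ℝ (Fin (n + 1)), ⟪J x, y⟫ = -⟪x, J y⟫)
    (ν : EuclideanSpace ℝ (Fin (n + 1)))
    (hν : ∀ v : TangentSpace (𝓡 n) p₀,
      @inner ℝ (EuclideanSpace ℝ (Fin (n + 1))) _
        (mfderiv (𝓡 n) 𝓘(ℝ, EuclideanSpace ℝ (Fin (n + 1))) f p₀ v) ν = 0) :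
    ⟪J (f p₀), ν⟫ = 0 := by
  have hd : MDifferentiableAt (𝓡 n) 𝓘(ℝ, EuclideanSpace ℝ (Fin (n + 1))) f p₀ :=
    (hf p₀).mdifferentiableAt (by simp)
  obtain ⟨L, hL⟩ : ∃ L : EuclideanSpace ℝ (Fin n) →L[ℝ] EuclideanSpace ℝ (Fin (n + 1)),
    L = mfderiv (𝓡 n) 𝓘(ℝ, EuclideanSpace ℝ (Fin (n + 1))) f p₀ := ⟨_, rfl⟩
  have h1 : HasFDerivWithinAt (writtenInExtChartAt (𝓡 n)
      𝓘(ℝ, EuclideanSpace ℝ (Fin (n + 1))) p₀ f) L (Set.range (𝓡 n))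
      (extChartAt (𝓡 n) p₀ p₀) := by
    subst hL
    exact hd.hasMFDerivAt.2
  have hinj' : Function.Injective L := by
    subst hL
    exact hinj
  have hν' : ∀ v, ⟪L v, ν⟫ = 0 := by
    subst hL
    exact hν
  rw [ModelWithCorners.Boundaryless.range_eq_univ, hasFDerivWithinAt_univ] at h1
  have hc : ContinuousAt (extChartAt (𝓡 n) p₀).symm (extChartAt (𝓡 n) p₀ p₀) :=
    continuousAt_extChartAt_symm p₀
  have hp : (extChartAt (𝓡 n) p₀).symm (extChartAt (𝓡 n) p₀ p₀) = p₀ :=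
    extChartAt_to_inv p₀
  have hw : writtenInExtChartAt (𝓡 n) 𝓘(ℝ, EuclideanSpace ℝ (Fin (n + 1))) p₀ f
      = fun z => f ((extChartAt (𝓡 n) p₀).symm z) := rfl
  rw [hw] at h1
  have hm : IsLocalMin (fun z => ‖f ((extChartAt (𝓡 n) p₀).symm z)‖) (extChartAt (𝓡 n) p₀ p₀) := by
    have h2 : Filter.Tendsto (extChartAt (𝓡 n) p₀).symm
        (nhds (extChartAt (𝓡 n) p₀ p₀)) (nhds p₀) := by
      simpa [ContinuousAt, hp] using hc
    filter_upwards [h2.eventually hmin] with z hz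
    show _ ≤ _
    rw [hp]
    exact hz
  have h3 := aux_crit _ _ _ h1 hm
  refine aux_linear L hinj' J hJ
    (f p₀) ν (fun v => ?_) hν'
  have h4 := h3 v
  rw [hp] at h4
  exact h4
end
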